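/- Let p ≥ 5 be a prime and let E be an elliptic curve over the finite field 𝔽_p. Then p² does not divide the order of the finite group E(𝔽_p). -/

import Mathlib

namespace WeierstrassCurve.Affine

open Classical in
/-- Over a field, an affine point is determined by its `x`-coordinate together with one bit. -/
theorem exists_injective_point_option_prod_bool {F : Type*} [Field F]
    (W : WeierstrassCurve.Affine F) :
    ∃ f : W.Point → Option (F × Bool), Function.Injective f := by
  have h : ∀ x : F, ∃ r : F, ∀ y, W.Equation x y → y = r ∨ y = W.negY x r := by
    intro x
    by_cases hx : ∃ r, W.Equation x r
    · obtain ⟨r, hr⟩ := hx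
      exact ⟨r, fun y hy => Y_eq_of_X_eq hy hr rfl⟩
    · exact ⟨0, fun y hy => (hx ⟨y, hy⟩).elim⟩
  choose r hr using h
  refine ⟨fun P => match P with
    | .zero => none
    | .some x y _ => some (x, decide (y = r x)), ?_⟩
  rintro (_ | ⟨x₁, y₁, h₁⟩) (_ | ⟨x₂, y₂, h₂⟩) h
  · rfl
  · simp at h
  · simp at h
  · simp only [Option.some.injEq, Prod.mk.injEq, decide_eq_decide] at h
    obtain ⟨rfl, h⟩ := h
    have e₁ := hr x₁ y₁ h₁.1
    have e₂ := hr x₁ y₂ h₂.1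
    have : y₁ = y₂ := by grind
    subst this
    rfl

end WeierstrassCurve.Affine

/-- For a prime `p ≥ 5` and an elliptic curve `E` over `𝔽_p`, the square `p²` does not divide
the order of `E(𝔽_p)`. -/
theorem sq_prime_not_dvd_card_points (p : ℕ) [Fact p.Prime] (hp5 : 5 ≤ p)
    (W : WeierstrassCurve (ZMod p)) (hW : W.Δ ≠ 0) :
    ¬ p ^ 2 ∣ Nat.card W.toAffine.Point := by
  obtain ⟨f, hf⟩ := W.toAffine.exists_injective_point_option_prod_bool
  have hfin : Finite W.toAffine.Point := Finite.of_injective f hf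
  have hcard : Nat.card W.toAffine.Point ≤ p * 2 + 1 := by
    simpa [Nat.card_eq_fintype_card, ZMod.card] using Nat.card_le_card_of_injective f hf
  intro hdvd
  have hle := Nat.le_of_dvd Nat.card_pos hdvd
  nlinarith
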